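/- arXiv:1204.6450 — 3 statements merged into one kernel-verified Lean document; each statement's English description precedes it below -/
import Mathlib

section
/- (Exponential-square integrability implies all L^q bounds; core of Lemma 2.3) Let Ω ⊂ ℝ² be a measurable set of finite Lebesgue measure |Ω|, let θ : Ω → [0,∞) be measurable, and let Λ > 0 satisfy ∫_Ω ( exp( (log(1+θ(x))/Λ)² ) − 1 ) dx ≤ 1. Then for every q ≥ 1: ∫_Ω θ(x)^q dx ≤ (e^{qΛ²} − 1)^q·|Ω| + 1 + |Ω|. -/
noncomputable section
open MeasureTheory

/-- Pointwise bound: either `log (1 + t) ≤ q Λ²`, and `t ^ q` is bounded by a constant, or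
`q log (1 + t) ≤ (log (1 + t) / Λ)²`. -/
theorem rpow_le_const_add_exp_sq_log {t q Λ : ℝ} (ht : 0 ≤ t) (hq : 0 ≤ q) (hΛ : 0 < Λ) :
    t ^ q ≤ ((Real.exp (q * Λ ^ 2) - 1) ^ q + 1)
      + (Real.exp ((Real.log (1 + t) / Λ) ^ 2) - 1) := by
  have h1t : 0 < 1 + t := by linarith
  have hM : 0 ≤ (Real.exp (q * Λ ^ 2) - 1) ^ q :=
    Real.rpow_nonneg (sub_nonneg.2 (Real.one_le_exp (by positivity))) q
  rcases le_total (Real.log (1 + t)) (q * Λ ^ 2) with hle | hle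
  · have hexp : 1 + t ≤ Real.exp (q * Λ ^ 2) := (Real.log_le_iff_le_exp h1t).1 hle
    have hpow : t ^ q ≤ (Real.exp (q * Λ ^ 2) - 1) ^ q :=
      Real.rpow_le_rpow ht (by linarith) hq
    have := Real.exp_pos ((Real.log (1 + t) / Λ) ^ 2)
    linarith
  · have hlog : 0 ≤ Real.log (1 + t) := Real.log_nonneg (by linarith)
    have hexponent : Real.log (1 + t) * q ≤ (Real.log (1 + t) / Λ) ^ 2 := by
      rw [div_pow, le_div_iff₀ (by positivity)]
      nlinarith
    have hpow : t ^ q ≤ Real.exp ((Real.log (1 + t) / Λ) ^ 2) :=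
      calc t ^ q ≤ (1 + t) ^ q := Real.rpow_le_rpow ht (by linarith) hq
        _ = Real.exp (Real.log (1 + t) * q) := Real.rpow_def_of_pos h1t q
        _ ≤ _ := Real.exp_le_exp.2 hexponent
    linarith

/-- (Exponential-square integrability implies all `L^q` bounds; core of Lemma 2.3)
If `θ ≥ 0` on a finite-measure set `Ω ⊂ ℝ²` and
`∫_Ω (exp((log(1+θ)/Λ)²) − 1) ≤ 1`, then for every `q ≥ 1`,
`∫_Ω θ^q ≤ (e^{qΛ²} − 1)^q·|Ω| + 1 + |Ω|`. -/
theorem exp_square_integrability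
    (Ω : Set (EuclideanSpace ℝ (Fin 2))) (hΩ : MeasurableSet Ω)
    (hΩfin : MeasureTheory.volume Ω < ⊤)
    (θ : EuclideanSpace ℝ (Fin 2) → ℝ) (hθm : Measurable θ)
    (hθ0 : ∀ x ∈ Ω, 0 ≤ θ x)
    (Λ : ℝ) (hΛ : 0 < Λ)
    (h : ∫⁻ x in Ω, ENNReal.ofReal (Real.exp ((Real.log (1 + θ x) / Λ) ^ 2) - 1) ≤ 1) :
    ∀ q : ℝ, 1 ≤ q →
      (∫⁻ x in Ω, ENNReal.ofReal (θ x ^ q))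
        ≤ ENNReal.ofReal ((Real.exp (q * Λ ^ 2) - 1) ^ q * (MeasureTheory.volume Ω).toReal
            + 1 + (MeasureTheory.volume Ω).toReal) := by
  intro q hq
  set M : ℝ := (Real.exp (q * Λ ^ 2) - 1) ^ q
  have hM : 0 ≤ M :=
    Real.rpow_nonneg (sub_nonneg.2 (Real.one_le_exp (by positivity))) q
  have hV : 0 ≤ (volume Ω).toReal := ENNReal.toReal_nonneg
  calc ∫⁻ x in Ω, ENNReal.ofReal (θ x ^ q)
      ≤ ∫⁻ x in Ω, (ENNReal.ofReal (M + 1)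
          + ENNReal.ofReal (Real.exp ((Real.log (1 + θ x) / Λ) ^ 2) - 1)) := by
        refine setLIntegral_mono' hΩ fun x hx => ?_
        rw [← ENNReal.ofReal_add (by positivity)
          (sub_nonneg.2 (Real.one_le_exp (by positivity)))]
        exact ENNReal.ofReal_le_ofReal
          (rpow_le_const_add_exp_sq_log (hθ0 x hx) (by linarith) hΛ)
    _ = ENNReal.ofReal (M + 1) * volume Ω
          + ∫⁻ x in Ω, ENNReal.ofReal (Real.exp ((Real.log (1 + θ x) / Λ) ^ 2) - 1) := by
        rw [lintegral_add_left measurable_const, setLIntegral_const]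
    _ ≤ ENNReal.ofReal (M + 1) * ENNReal.ofReal (volume Ω).toReal + ENNReal.ofReal 1 := by
        rw [ENNReal.ofReal_toReal hΩfin.ne, ENNReal.ofReal_one]
        gcongr
    _ = ENNReal.ofReal (M * (volume Ω).toReal + 1 + (volume Ω).toReal) := by
        rw [← ENNReal.ofReal_mul (by positivity), ← ENNReal.ofReal_add (by positivity) zero_le_one]
        congr 1
        ring
end
end

section
/- (Lemma 2.1: energy and entropy estimates) There exists a constant C > 0 depending only on T, R, C₀, M₀, C_f, μ, λ, κ, K — and in particular independent of ε — such that every smooth approximate solution (ρ,u,θ) satisfies, for all t ∈ [0,T]: (i) ∫_ε^R ρ(t,r) r dr = M₀; (ii) ∫_ε^R ρ(t,r)·[u(t,r)²/2 + θ(t,r)] r dr ≤ C; (iii) ∫_ε^R ρ(t,r)·S(t,r) r dr + ∫_0^t ∫_ε^R [ κ·(θ_r/θ)² + Q/θ ] r dr ds ≤ C, where S := K·Ψ(1/ρ) + Ψ(θ) + u²/2 with Ψ(s) := s − log s − 1, and Q := ν·(u_r + u/r)² − (2μ/r)·(u²)_r. -/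
noncomputable section
open MeasureTheory Set

/-- `Ψ(s) = s − log s − 1`. -/
def Psi (s : ℝ) : ℝ := s - Real.log s - 1

/-- The viscous dissipation `Q = ν(u_r + u/r)² − (2μ/r)·(u²)_r` with `ν = λ + 2μ`. -/
def Qvisc (μ lam u ur r : ℝ) : ℝ :=
  (lam + 2 * μ) * (ur + u / r) ^ 2 - 2 * μ / r * (2 * u * ur)

/-- A smooth approximate solution of the spherically symmetric compressible Navier–Stokes
equations on the annulus `[ε,R]` over the time interval `[0,T]`, with viscosity constants
`μ, λ`, heat conductivity `κ`, gas constant `K`, data constants `C₀` (initial bounds),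
`M₀` (total mass) and `C_f` (force bounds).  The fields `ρt, ρr, ut, ur, urr, θt, θr, θrr`
are the partial derivatives of the density `ρ`, velocity `u` and temperature `θ`. -/
structure ApproxSol (μ lam κ K ε R T C₀ M₀ Cf : ℝ) where
  ρ : ℝ → ℝ → ℝ
  u : ℝ → ℝ → ℝ
  θ : ℝ → ℝ → ℝ
  f : ℝ → ℝ → ℝ
  ρt : ℝ → ℝ → ℝ
  ρr : ℝ → ℝ → ℝ
  ut : ℝ → ℝ → ℝ
  ur : ℝ → ℝ → ℝ
  urr : ℝ → ℝ → ℝ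
  θt : ℝ → ℝ → ℝ
  θr : ℝ → ℝ → ℝ
  θrr : ℝ → ℝ → ℝ
  smooth_ρ : ContDiffOn ℝ (⊤ : ℕ∞) (Function.uncurry ρ) (Icc 0 T ×ˢ Icc ε R)
  smooth_u : ContDiffOn ℝ (⊤ : ℕ∞) (Function.uncurry u) (Icc 0 T ×ˢ Icc ε R)
  smooth_θ : ContDiffOn ℝ (⊤ : ℕ∞) (Function.uncurry θ) (Icc 0 T ×ˢ Icc ε R)
  smooth_f : ContDiffOn ℝ (⊤ : ℕ∞) (Function.uncurry f) (Icc 0 T ×ˢ Icc ε R)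
  hρt : ∀ t ∈ Icc (0:ℝ) T, ∀ r ∈ Icc ε R, HasDerivAt (fun s => ρ s r) (ρt t r) t
  hρr : ∀ t ∈ Icc (0:ℝ) T, ∀ r ∈ Icc ε R, HasDerivAt (fun x => ρ t x) (ρr t r) r
  hut : ∀ t ∈ Icc (0:ℝ) T, ∀ r ∈ Icc ε R, HasDerivAt (fun s => u s r) (ut t r) t
  hur : ∀ t ∈ Icc (0:ℝ) T, ∀ r ∈ Icc ε R, HasDerivAt (fun x => u t x) (ur t r) r
  hurr : ∀ t ∈ Icc (0:ℝ) T, ∀ r ∈ Icc ε R, HasDerivAt (fun x => ur t x) (urr t r) r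
  hθt : ∀ t ∈ Icc (0:ℝ) T, ∀ r ∈ Icc ε R, HasDerivAt (fun s => θ s r) (θt t r) t
  hθr : ∀ t ∈ Icc (0:ℝ) T, ∀ r ∈ Icc ε R, HasDerivAt (fun x => θ t x) (θr t r) r
  hθrr : ∀ t ∈ Icc (0:ℝ) T, ∀ r ∈ Icc ε R, HasDerivAt (fun x => θr t x) (θrr t r) r
  ρ_pos : ∀ t ∈ Icc (0:ℝ) T, ∀ r ∈ Icc ε R, 0 < ρ t r
  θ_pos : ∀ t ∈ Icc (0:ℝ) T, ∀ r ∈ Icc ε R, 0 < θ t r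
  /-- mass equation `ρ_t + (ρu)_r + ρu/r = 0` -/
  mass_eq : ∀ t ∈ Icc (0:ℝ) T, ∀ r ∈ Icc ε R,
    ρt t r + (ρr t r * u t r + ρ t r * ur t r) + ρ t r * u t r / r = 0
  /-- momentum equation `(ρu)_t + (ρu²)_r + ρu²/r + P_r − ν(u_r + u/r)_r = ρf`, `P = Kρθ` -/
  momentum_eq : ∀ t ∈ Icc (0:ℝ) T, ∀ r ∈ Icc ε R,
    (ρt t r * u t r + ρ t r * ut t r)
      + (ρr t r * (u t r) ^ 2 + 2 * ρ t r * u t r * ur t r)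
      + ρ t r * (u t r) ^ 2 / r
      + K * (ρr t r * θ t r + ρ t r * θr t r)
      - (lam + 2 * μ) * (urr t r + ur t r / r - u t r / r ^ 2)
    = ρ t r * f t r
  /-- energy equation `(ρθ)_t + (ρuθ)_r + ρuθ/r − κ(θ_rr + θ_r/r) + P(u_r + u/r) = Q` -/
  energy_eq : ∀ t ∈ Icc (0:ℝ) T, ∀ r ∈ Icc ε R,
    (ρt t r * θ t r + ρ t r * θt t r)
      + (ρr t r * u t r * θ t r + ρ t r * ur t r * θ t r + ρ t r * u t r * θr t r)
      + ρ t r * u t r * θ t r / r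
      - κ * (θrr t r + θr t r / r)
      + K * ρ t r * θ t r * (ur t r + u t r / r)
    = Qvisc μ lam (u t r) (ur t r) r
  bc_u : ∀ t ∈ Icc (0:ℝ) T, u t ε = 0 ∧ u t R = 0
  bc_θ : ∀ t ∈ Icc (0:ℝ) T, θr t ε = 0 ∧ θr t R = 0
  init_ρ : ∀ r ∈ Icc ε R, C₀⁻¹ ≤ ρ 0 r ∧ ρ 0 r ≤ C₀
  init_θ : ∀ r ∈ Icc ε R, C₀⁻¹ ≤ θ 0 r
  init_entropy :
    (∫ r in ε..R, ρ 0 r * (K * Psi (1 / ρ 0 r) + Psi (θ 0 r) + (u 0 r) ^ 2 / 2) * r) ≤ C₀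
  init_mass : (∫ r in ε..R, ρ 0 r * r) = M₀
  force_int : (∫ t in (0:ℝ)..T, (⨆ r : Icc ε R, |f t (r : ℝ)|)) ≤ Cf
  force_sq : ∀ t ∈ Icc (0:ℝ) T, (∫ r in ε..R, (f t r) ^ 2 * r) ≤ Cf

/-- A function continuous on a closed rectangle agrees there with a continuous function. -/
theorem exists_continuous_eq_on_rectangle {a b c d : ℝ} (hab : a ≤ b) (hcd : c ≤ d)
    {h : ℝ → ℝ → ℝ} (hh : ContinuousOn (Function.uncurry h) (Icc a b ×ˢ Icc c d)) :
    ∃ g : ℝ → ℝ → ℝ, Continuous (Function.uncurry g) ∧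
      ∀ t ∈ Icc a b, ∀ r ∈ Icc c d, g t r = h t r := by
  refine ⟨fun t r => h (projIcc a b hab t) (projIcc c d hcd r), ?_, ?_⟩
  · have hproj : Continuous fun p : ℝ × ℝ =>
        ((projIcc a b hab p.1 : ℝ), (projIcc c d hcd p.2 : ℝ)) := by fun_prop
    exact hh.comp_continuous hproj fun p => ⟨Subtype.coe_prop _, Subtype.coe_prop _⟩
  · intro t ht r hr
    simp only [projIcc_of_mem hab ht, projIcc_of_mem hcd hr]

/-- The first partial derivative of a smooth function on a closed rectangle is smooth. -/
theorem contDiffOn_partial_fst {a b c d : ℝ} (hab : a < b) (hcd : c < d) {φ φ' : ℝ → ℝ → ℝ}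
    (hφ : ContDiffOn ℝ (⊤ : ℕ∞) (Function.uncurry φ) (Icc a b ×ˢ Icc c d))
    (hd : ∀ t ∈ Icc a b, ∀ r ∈ Icc c d, HasDerivAt (fun s => φ s r) (φ' t r) t) :
    ContDiffOn ℝ (⊤ : ℕ∞) (Function.uncurry φ') (Icc a b ×ˢ Icc c d) := by
  have hu : UniqueDiffOn ℝ (Icc a b ×ˢ Icc c d) :=
    (uniqueDiffOn_Icc hab).prod (uniqueDiffOn_Icc hcd)
  have hsm : ContDiffOn ℝ (⊤ : ℕ∞)
      (fun p => fderivWithin ℝ (Function.uncurry φ) (Icc a b ×ˢ Icc c d) p (1, 0))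
      (Icc a b ×ˢ Icc c d) :=
    (hφ.fderivWithin hu (m := (⊤ : ℕ∞)) (by simp)).clm_apply contDiffOn_const
  refine hsm.congr ?_
  rintro ⟨t, r⟩ ⟨ht, hr⟩
  have hf := (hφ.differentiableOn (by simp) (t, r) ⟨ht, hr⟩).hasFDerivWithinAt
  have hline : HasDerivWithinAt (fun s : ℝ => (s, r)) ((1 : ℝ), (0 : ℝ)) (Icc a b) t :=
    ((hasDerivAt_id t).prodMk (hasDerivAt_const t r)).hasDerivWithinAt
  have hcomp := hf.comp_hasDerivWithinAt t hline fun s hs => mk_mem_prod hs hr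
  exact (uniqueDiffOn_Icc hab t ht).eq_deriv _ (hd t ht r hr).hasDerivWithinAt hcomp

/-- The second partial derivative of a smooth function on a closed rectangle is smooth. -/
theorem contDiffOn_partial_snd {a b c d : ℝ} (hab : a < b) (hcd : c < d) {φ φ' : ℝ → ℝ → ℝ}
    (hφ : ContDiffOn ℝ (⊤ : ℕ∞) (Function.uncurry φ) (Icc a b ×ˢ Icc c d))
    (hd : ∀ t ∈ Icc a b, ∀ r ∈ Icc c d, HasDerivAt (fun x => φ t x) (φ' t r) r) :
    ContDiffOn ℝ (⊤ : ℕ∞) (Function.uncurry φ') (Icc a b ×ˢ Icc c d) := by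
  have hu : UniqueDiffOn ℝ (Icc a b ×ˢ Icc c d) :=
    (uniqueDiffOn_Icc hab).prod (uniqueDiffOn_Icc hcd)
  have hsm : ContDiffOn ℝ (⊤ : ℕ∞)
      (fun p => fderivWithin ℝ (Function.uncurry φ) (Icc a b ×ˢ Icc c d) p (0, 1))
      (Icc a b ×ˢ Icc c d) :=
    (hφ.fderivWithin hu (m := (⊤ : ℕ∞)) (by simp)).clm_apply contDiffOn_const
  refine hsm.congr ?_
  rintro ⟨t, r⟩ ⟨ht, hr⟩
  have hf := (hφ.differentiableOn (by simp) (t, r) ⟨ht, hr⟩).hasFDerivWithinAt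
  have hline : HasDerivWithinAt (fun x : ℝ => (t, x)) ((0 : ℝ), (1 : ℝ)) (Icc c d) r :=
    ((hasDerivAt_const r t).prodMk (hasDerivAt_id r)).hasDerivWithinAt
  have hcomp := hf.comp_hasDerivWithinAt r hline fun x hx => mk_mem_prod ht hx
  exact (uniqueDiffOn_Icc hcd r hr).eq_deriv _ (hd t ht r hr).hasDerivWithinAt hcomp

/-- Time slices of a function continuous on a rectangle are interval integrable. -/
theorem intervalIntegrable_slice {a b c d : ℝ} (hcd : c ≤ d) {h : ℝ → ℝ → ℝ}
    (hh : ContinuousOn (Function.uncurry h) (Icc a b ×ˢ Icc c d)) {t : ℝ} (ht : t ∈ Icc a b) :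
    IntervalIntegrable (h t) volume c d := by
  refine ContinuousOn.intervalIntegrable_of_Icc hcd ?_
  exact hh.comp (f := fun r => (t, r)) (by fun_prop) fun r hr => mk_mem_prod ht hr

/-- Integrated form of the balance law `∂ₜG = ∂ᵣH + D` when the flux `H` vanishes at both
endpoints. -/
theorem integral_sub_integral_of_balance_law {T c d : ℝ} (hcd : c ≤ d)
    {G Gt H Hr D : ℝ → ℝ → ℝ}
    (hGd : ∀ t ∈ Icc 0 T, ∀ r ∈ Icc c d, HasDerivAt (fun s => G s r) (Gt t r) t)
    (hHd : ∀ t ∈ Icc 0 T, ∀ r ∈ Icc c d, HasDerivAt (fun x => H t x) (Hr t r) r)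
    (hGc : ContinuousOn (Function.uncurry G) (Icc 0 T ×ˢ Icc c d))
    (hGtc : ContinuousOn (Function.uncurry Gt) (Icc 0 T ×ˢ Icc c d))
    (hDc : ContinuousOn (Function.uncurry D) (Icc 0 T ×ˢ Icc c d))
    (hbal : ∀ t ∈ Icc 0 T, ∀ r ∈ Icc c d, Gt t r = Hr t r + D t r)
    (hHc : ∀ t ∈ Icc 0 T, H t c = 0) (hHd0 : ∀ t ∈ Icc 0 T, H t d = 0)
    {t : ℝ} (ht : t ∈ Icc 0 T) :
    (∫ r in c..d, G t r) - (∫ r in c..d, G 0 r) = ∫ τ in (0 : ℝ)..t, ∫ r in c..d, D τ r := by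
  have hsub : Icc 0 t ⊆ Icc 0 T := Icc_subset_Icc_right ht.2
  have h0 : (0 : ℝ) ∈ Icc 0 T := ⟨le_rfl, ht.1.trans ht.2⟩
  rw [← intervalIntegral.integral_sub (intervalIntegrable_slice hcd hGc ht)
    (intervalIntegrable_slice hcd hGc h0)]
  have htime : ∀ r ∈ uIcc c d, G t r - G 0 r = ∫ τ in (0 : ℝ)..t, Gt τ r := by
    intro r hr
    rw [uIcc_of_le hcd] at hr
    refine (intervalIntegral.integral_eq_sub_of_hasDerivAt (f := fun s => G s r) ?_ ?_).symm
    · intro τ hτ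
      rw [uIcc_of_le ht.1] at hτ
      exact hGd τ (hsub hτ) r hr
    · refine ContinuousOn.intervalIntegrable_of_Icc ht.1 ?_
      exact hGtc.comp (f := fun τ => (τ, r)) (by fun_prop) fun τ hτ => mk_mem_prod (hsub hτ) hr
  rw [intervalIntegral.integral_congr htime,
    ← intervalIntegral_intervalIntegral_swap (F := Gt)]
  · refine intervalIntegral.integral_congr fun τ hτ => ?_
    rw [uIcc_of_le ht.1] at hτ
    have hτT := hsub hτ
    have hGtI := intervalIntegrable_slice hcd hGtc hτT
    have hDI := intervalIntegrable_slice hcd hDc hτT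
    have hflux : ∫ r in c..d, (Gt τ r - D τ r) = H τ d - H τ c := by
      refine intervalIntegral.integral_eq_sub_of_hasDerivAt ?_ (hGtI.sub hDI)
      intro r hr
      rw [uIcc_of_le hcd] at hr
      rw [hbal τ hτT r hr, add_sub_cancel_right]
      exact hHd τ hτT r hr
    rw [intervalIntegral.integral_sub hGtI hDI, hHc τ hτT, hHd0 τ hτT] at hflux
    linarith
  · rw [uIoc_of_le ht.1, uIoc_of_le hcd]
    exact ((hGtc.mono (prod_mono hsub subset_rfl)).integrableOn_compact
      (isCompact_Icc.prod isCompact_Icc)).mono_set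
      (prod_mono Ioc_subset_Icc_self Ioc_subset_Icc_self)

/-- Grönwall's inequality with a variable coefficient for a positive function. -/
theorem gronwall_of_pos {T y₀ : ℝ} {g F : ℝ → ℝ} (hg : Continuous g) (hF : Continuous F)
    (hpos : ∀ t ∈ Icc 0 T, 0 < y₀ + ∫ τ in (0 : ℝ)..t, g τ)
    (hle : ∀ t ∈ Icc 0 T, g t ≤ F t * (y₀ + ∫ τ in (0 : ℝ)..t, g τ))
    {t : ℝ} (ht : t ∈ Icc 0 T) :
    y₀ + ∫ τ in (0 : ℝ)..t, g τ ≤ y₀ * Real.exp (∫ τ in (0 : ℝ)..t, F τ) := by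
  set y : ℝ → ℝ := fun t => y₀ + ∫ τ in (0 : ℝ)..t, g τ with hy
  have hyd : ∀ x, HasDerivAt y (g x) x := fun x =>
    (hg.integral_hasStrictDerivAt 0 x).hasDerivAt.const_add y₀
  have hyc : Continuous y := continuous_iff_continuousAt.2 fun x => (hyd x).continuousAt
  have hsub : Icc 0 t ⊆ Icc 0 T := Icc_subset_Icc_right ht.2
  have hquot : IntervalIntegrable (fun τ => g τ / y τ) volume 0 t :=
    ContinuousOn.intervalIntegrable_of_Icc ht.1
      (hg.continuousOn.div hyc.continuousOn fun τ hτ => (hpos τ (hsub hτ)).ne')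
  have hlog : ∫ τ in (0 : ℝ)..t, g τ / y τ = Real.log (y t) - Real.log (y 0) := by
    refine intervalIntegral.integral_eq_sub_of_hasDerivAt (f := fun τ => Real.log (y τ)) ?_ hquot
    intro τ hτ
    rw [uIcc_of_le ht.1] at hτ
    exact (hyd τ).log (hpos τ (hsub hτ)).ne'
  have hmono : ∫ τ in (0 : ℝ)..t, g τ / y τ ≤ ∫ τ in (0 : ℝ)..t, F τ := by
    refine intervalIntegral.integral_mono_on ht.1 hquot (hF.intervalIntegrable _ _) ?_
    intro τ hτ
    exact (div_le_iff₀ (hpos τ (hsub hτ))).2 (hle τ (hsub hτ))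
  have hy0 : y 0 = y₀ := by simp [hy]
  have hy₀ : 0 < y₀ := hy0 ▸ hpos 0 ⟨le_rfl, ht.1.trans ht.2⟩
  have hyt : 0 < y t := hpos t ht
  rw [hy0] at hlog
  change y t ≤ _
  calc y t = Real.exp (Real.log (y t)) := (Real.exp_log hyt).symm
    _ ≤ Real.exp (Real.log y₀ + ∫ τ in (0 : ℝ)..t, F τ) := Real.exp_le_exp.2 (by linarith)
    _ = y₀ * Real.exp (∫ τ in (0 : ℝ)..t, F τ) := by rw [Real.exp_add, Real.exp_log hy₀]

/-- For a function continuous on a closed rectangle, the supremum over `r` of its absolute value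
agrees for `t ∈ [a,b]` with a continuous function of `t`. -/
theorem exists_continuous_iSup_abs {a b c d : ℝ} (hab : a ≤ b) (hcd : c ≤ d)
    {f : ℝ → ℝ → ℝ} (hf : ContinuousOn (Function.uncurry f) (Icc a b ×ˢ Icc c d)) :
    ∃ F : ℝ → ℝ, Continuous F ∧ (∀ t ∈ Icc a b, F t = ⨆ r : Icc c d, |f t (r : ℝ)|) ∧
      ∀ t ∈ Icc a b, ∀ r ∈ Icc c d, |f t r| ≤ F t := by
  obtain ⟨g, hg, hgf⟩ := exists_continuous_eq_on_rectangle hab hcd hf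
  have hga : Continuous (Function.uncurry fun t r => |g t r|) := hg.abs
  refine ⟨fun t => sSup ((fun r => |g t r|) '' Icc c d), isCompact_Icc.continuous_sSup hga, ?_, ?_⟩
  · intro t ht
    simp only [sSup_image']
    exact iSup_congr fun r => by rw [hgf t ht r r.2]
  · intro t ht r hr
    rw [← hgf t ht r hr]
    have hslice : Continuous fun r => |g t r| := hga.comp (by fun_prop : Continuous fun r => (t, r))
    exact le_csSup (isCompact_Icc.image hslice).bddAbove ⟨r, hr, rfl⟩

theorem Psi_nonneg {x : ℝ} (hx : 0 < x) : 0 ≤ Psi x := by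
  have := Real.log_le_sub_one_of_pos hx
  unfold Psi
  linarith

theorem le_two_mul_Psi_add_two {x : ℝ} (hx : 0 < x) : x ≤ 2 * Psi x + 2 := by
  have h := Real.log_le_sub_one_of_pos (half_pos hx)
  rw [Real.log_div hx.ne' two_ne_zero] at h
  have h2 := Real.log_le_sub_one_of_pos (zero_lt_two (α := ℝ))
  unfold Psi
  linarith

namespace ApproxSol

section

variable {μ lam κ K ε R T C₀ M₀ Cf : ℝ} (s : ApproxSol μ lam κ K ε R T C₀ M₀ Cf)

theorem continuousOn_ρt (hT : 0 < T) (hεR : ε < R) :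
    ContinuousOn (fun p : ℝ × ℝ => s.ρt p.1 p.2) (Icc 0 T ×ˢ Icc ε R) :=
  (contDiffOn_partial_fst hT hεR s.smooth_ρ s.hρt).continuousOn

/-- Conservation of mass. -/
theorem integral_mass (hT : 0 < T) (hε : 0 < ε) (hεR : ε < R) {t : ℝ} (ht : t ∈ Icc 0 T) :
    (∫ r in ε..R, s.ρ t r * r) = M₀ := by
  have cρ : ContinuousOn (fun p : ℝ × ℝ => s.ρ p.1 p.2) (Icc 0 T ×ˢ Icc ε R) :=
    s.smooth_ρ.continuousOn
  have cρt := s.continuousOn_ρt hT hεR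
  have hbal := integral_sub_integral_of_balance_law hεR.le
    (G := fun t r => s.ρ t r * r) (Gt := fun t r => s.ρt t r * r)
    (H := fun t r => -(s.ρ t r * s.u t r * r))
    (Hr := fun t r => -((s.ρr t r * s.u t r + s.ρ t r * s.ur t r) * r + s.ρ t r * s.u t r * 1))
    (D := fun _ _ => 0)
    (fun t ht r hr => (s.hρt t ht r hr).mul_const r)
    (fun t ht r hr => (((s.hρr t ht r hr).mul (s.hur t ht r hr)).mul (hasDerivAt_id r)).neg)
    (by unfold Function.uncurry; fun_prop) (by unfold Function.uncurry; fun_prop)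
    (by unfold Function.uncurry; fun_prop)
    (fun t ht r hr => by
      have hr0 : r ≠ 0 := (hε.trans_le hr.1).ne'
      have h := s.mass_eq t ht r hr
      field_simp at h
      linear_combination h)
    (fun t ht => by simp [(s.bc_u t ht).1]) (fun t ht => by simp [(s.bc_u t ht).2]) ht
  have h0 := s.init_mass
  simp only [intervalIntegral.integral_zero] at hbal
  linarith

/-- Balance of the total energy: only the force does work. -/
theorem integral_energy_sub (hT : 0 < T) (hε : 0 < ε) (hεR : ε < R) {t : ℝ}
    (ht : t ∈ Icc 0 T) :
    (∫ r in ε..R, s.ρ t r * ((s.u t r) ^ 2 / 2 + s.θ t r) * r)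
      - (∫ r in ε..R, s.ρ 0 r * ((s.u 0 r) ^ 2 / 2 + s.θ 0 r) * r)
    = ∫ τ in (0 : ℝ)..t, ∫ r in ε..R, s.ρ τ r * s.f τ r * s.u τ r * r := by
  have cρ : ContinuousOn (fun p : ℝ × ℝ => s.ρ p.1 p.2) (Icc 0 T ×ˢ Icc ε R) :=
    s.smooth_ρ.continuousOn
  have cu : ContinuousOn (fun p : ℝ × ℝ => s.u p.1 p.2) (Icc 0 T ×ˢ Icc ε R) :=
    s.smooth_u.continuousOn
  have cθ : ContinuousOn (fun p : ℝ × ℝ => s.θ p.1 p.2) (Icc 0 T ×ˢ Icc ε R) :=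
    s.smooth_θ.continuousOn
  have cf : ContinuousOn (fun p : ℝ × ℝ => s.f p.1 p.2) (Icc 0 T ×ˢ Icc ε R) :=
    s.smooth_f.continuousOn
  have cρt := s.continuousOn_ρt hT hεR
  have cut : ContinuousOn (fun p : ℝ × ℝ => s.ut p.1 p.2) (Icc 0 T ×ˢ Icc ε R) :=
    (contDiffOn_partial_fst hT hεR s.smooth_u s.hut).continuousOn
  have cθt : ContinuousOn (fun p : ℝ × ℝ => s.θt p.1 p.2) (Icc 0 T ×ˢ Icc ε R) :=
    (contDiffOn_partial_fst hT hεR s.smooth_θ s.hθt).continuousOn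
  refine integral_sub_integral_of_balance_law hεR.le
    (G := fun t r => s.ρ t r * ((s.u t r) ^ 2 / 2 + s.θ t r) * r)
    (Gt := fun t r => (s.ρt t r * ((s.u t r) ^ 2 / 2 + s.θ t r)
      + s.ρ t r * (s.u t r * s.ut t r + s.θt t r)) * r)
    (H := fun t r => -(s.ρ t r * s.u t r * ((s.u t r) ^ 2 / 2 + s.θ t r) * r)
      - K * (s.ρ t r * s.θ t r * s.u t r * r)
      + (lam + 2 * μ) * (s.u t r * s.ur t r * r + (s.u t r) ^ 2)
      - 2 * μ * (s.u t r) ^ 2 + κ * (s.θr t r * r))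
    (Hr := fun t r =>
      -(((s.ρr t r * s.u t r + s.ρ t r * s.ur t r) * ((s.u t r) ^ 2 / 2 + s.θ t r)
          + s.ρ t r * s.u t r * (s.u t r * s.ur t r + s.θr t r)) * r
        + s.ρ t r * s.u t r * ((s.u t r) ^ 2 / 2 + s.θ t r))
      - K * (((s.ρr t r * s.θ t r + s.ρ t r * s.θr t r) * s.u t r
          + s.ρ t r * s.θ t r * s.ur t r) * r + s.ρ t r * s.θ t r * s.u t r)
      + (lam + 2 * μ) * ((s.ur t r * s.ur t r + s.u t r * s.urr t r) * r + s.u t r * s.ur t r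
          + 2 * s.u t r * s.ur t r)
      - 2 * μ * (2 * s.u t r * s.ur t r) + κ * (s.θrr t r * r + s.θr t r))
    (D := fun t r => s.ρ t r * s.f t r * s.u t r * r) ?_ ?_
    (by unfold Function.uncurry; fun_prop) (by unfold Function.uncurry; fun_prop)
    (by unfold Function.uncurry; fun_prop) ?_ ?_ ?_ ht
  · intro t ht r hr
    refine (((s.hρt t ht r hr).mul ((((s.hut t ht r hr).pow 2).div_const 2).add
      (s.hθt t ht r hr))).mul_const r).congr_deriv ?_
    simp only [Pi.add_apply, Pi.pow_apply]
    push_cast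
    ring
  · intro t ht r hr
    have dρ := s.hρr t ht r hr
    have du := s.hur t ht r hr
    have dur := s.hurr t ht r hr
    have dθ := s.hθr t ht r hr
    have dθr := s.hθrr t ht r hr
    have dr := hasDerivAt_id' r
    refine (((((((dρ.fun_mul du).fun_mul
      (((du.fun_pow 2).div_const 2).fun_add dθ)).fun_mul dr).fun_neg.fun_sub
      ((((dρ.fun_mul dθ).fun_mul du).fun_mul dr).const_mul K)).fun_add
      ((((du.fun_mul dur).fun_mul dr).fun_add (du.fun_pow 2)).const_mul (lam + 2 * μ))).fun_sub
      ((du.fun_pow 2).const_mul (2 * μ))).fun_add ((dθr.fun_mul dr).const_mul κ)).congr_deriv ?_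
    push_cast
    ring
  · intro t ht r hr
    have hr0 : r ≠ 0 := (hε.trans_le hr.1).ne'
    have hm := s.mass_eq t ht r hr
    have hp := s.momentum_eq t ht r hr
    have he := s.energy_eq t ht r hr
    unfold Qvisc at he
    have hcomb := congrArg₂ (· + ·) (congrArg₂ (· + ·) (congrArg (s.u t r * r * ·) hp)
      (congrArg (r * ·) he)) (congrArg (-((s.u t r) ^ 2 / 2) * r * ·) hm)
    rw [← sub_eq_zero] at hcomb ⊢
    rw [← hcomb]
    field_simp
    ring
  · intro t ht
    simp [(s.bc_u t ht).1, (s.bc_θ t ht).1]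
  · intro t ht
    simp [(s.bc_u t ht).2, (s.bc_θ t ht).2]

/-- Balance of the thermodynamic entropy `ρ (log θ - K log ρ)`, which is produced by heat
conduction and viscous dissipation. -/
theorem integral_entropy_sub (hT : 0 < T) (hε : 0 < ε) (hεR : ε < R) {t : ℝ}
    (ht : t ∈ Icc 0 T) :
    (∫ r in ε..R, s.ρ t r * (Real.log (s.θ t r) - K * Real.log (s.ρ t r)) * r)
      - (∫ r in ε..R, s.ρ 0 r * (Real.log (s.θ 0 r) - K * Real.log (s.ρ 0 r)) * r)
    = ∫ τ in (0 : ℝ)..t, ∫ r in ε..R, (κ * (s.θr τ r / s.θ τ r) ^ 2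
        + Qvisc μ lam (s.u τ r) (s.ur τ r) r / s.θ τ r) * r := by
  have cρ : ContinuousOn (fun p : ℝ × ℝ => s.ρ p.1 p.2) (Icc 0 T ×ˢ Icc ε R) :=
    s.smooth_ρ.continuousOn
  have cu : ContinuousOn (fun p : ℝ × ℝ => s.u p.1 p.2) (Icc 0 T ×ˢ Icc ε R) :=
    s.smooth_u.continuousOn
  have cθ : ContinuousOn (fun p : ℝ × ℝ => s.θ p.1 p.2) (Icc 0 T ×ˢ Icc ε R) :=
    s.smooth_θ.continuousOn
  have cρt := s.continuousOn_ρt hT hεR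
  have cθt : ContinuousOn (fun p : ℝ × ℝ => s.θt p.1 p.2) (Icc 0 T ×ˢ Icc ε R) :=
    (contDiffOn_partial_fst hT hεR s.smooth_θ s.hθt).continuousOn
  have cur : ContinuousOn (fun p : ℝ × ℝ => s.ur p.1 p.2) (Icc 0 T ×ˢ Icc ε R) :=
    (contDiffOn_partial_snd hT hεR s.smooth_u s.hur).continuousOn
  have cθr : ContinuousOn (fun p : ℝ × ℝ => s.θr p.1 p.2) (Icc 0 T ×ˢ Icc ε R) :=
    (contDiffOn_partial_snd hT hεR s.smooth_θ s.hθr).continuousOn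
  have nρ : ∀ p ∈ Icc 0 T ×ˢ Icc ε R, s.ρ p.1 p.2 ≠ 0 := fun p hp =>
    (s.ρ_pos p.1 hp.1 p.2 hp.2).ne'
  have nθ : ∀ p ∈ Icc 0 T ×ˢ Icc ε R, s.θ p.1 p.2 ≠ 0 := fun p hp =>
    (s.θ_pos p.1 hp.1 p.2 hp.2).ne'
  have nr : ∀ p ∈ Icc (0 : ℝ) T ×ˢ Icc ε R, p.2 ≠ 0 := fun p hp =>
    (hε.trans_le hp.2.1).ne'
  have clρ := cρ.log nρ
  have clθ := cθ.log nθ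
  refine integral_sub_integral_of_balance_law hεR.le
    (G := fun t r => s.ρ t r * (Real.log (s.θ t r) - K * Real.log (s.ρ t r)) * r)
    (Gt := fun t r => (s.ρt t r * (Real.log (s.θ t r) - K * Real.log (s.ρ t r))
      + s.ρ t r * (s.θt t r / s.θ t r - K * (s.ρt t r / s.ρ t r))) * r)
    (H := fun t r => -(s.ρ t r * s.u t r
        * (Real.log (s.θ t r) - K * Real.log (s.ρ t r)) * r)
      + κ * (s.θr t r / s.θ t r * r))
    (Hr := fun t r =>
      -(((s.ρr t r * s.u t r + s.ρ t r * s.ur t r)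
          * (Real.log (s.θ t r) - K * Real.log (s.ρ t r))
          + s.ρ t r * s.u t r * (s.θr t r / s.θ t r - K * (s.ρr t r / s.ρ t r))) * r
        + s.ρ t r * s.u t r * (Real.log (s.θ t r) - K * Real.log (s.ρ t r)))
      + κ * ((s.θrr t r * s.θ t r - s.θr t r * s.θr t r) / s.θ t r ^ 2 * r
        + s.θr t r / s.θ t r))
    (D := fun t r => (κ * (s.θr t r / s.θ t r) ^ 2
        + Qvisc μ lam (s.u t r) (s.ur t r) r / s.θ t r) * r) ?_ ?_
    (by unfold Function.uncurry; fun_prop)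
    (by unfold Function.uncurry; fun_prop (disch := assumption))
    (by unfold Function.uncurry Qvisc; fun_prop (disch := assumption)) ?_ ?_ ?_ ht
  · intro t ht r hr
    have dlθ := (s.hθt t ht r hr).log (s.θ_pos t ht r hr).ne'
    have dlρ := (s.hρt t ht r hr).log (s.ρ_pos t ht r hr).ne'
    exact ((s.hρt t ht r hr).fun_mul (dlθ.fun_sub (dlρ.const_mul K))).mul_const r
  · intro t ht r hr
    have dρ := s.hρr t ht r hr
    have du := s.hur t ht r hr
    have dθ := s.hθr t ht r hr
    have dθr := s.hθrr t ht r hr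
    have dr := hasDerivAt_id' r
    have dlθ := dθ.log (s.θ_pos t ht r hr).ne'
    have dlρ := dρ.log (s.ρ_pos t ht r hr).ne'
    refine ((((dρ.fun_mul du).fun_mul (dlθ.fun_sub (dlρ.const_mul K))).fun_mul dr).fun_neg.fun_add
      (((dθr.fun_div dθ (s.θ_pos t ht r hr).ne').fun_mul dr).const_mul κ)).congr_deriv ?_
    ring
  · intro t ht r hr
    have hr0 : r ≠ 0 := (hε.trans_le hr.1).ne'
    have hρ0 := (s.ρ_pos t ht r hr).ne'
    have hθ0 := (s.θ_pos t ht r hr).ne'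
    have hm := s.mass_eq t ht r hr
    have he := s.energy_eq t ht r hr
    have hcomb := congrArg₂ (· + ·) (congrArg (r / s.θ t r * ·) he)
      (congrArg ((Real.log (s.θ t r) - K * Real.log (s.ρ t r) - 1 - K) * r * ·) hm)
    rw [← sub_eq_zero] at hcomb ⊢
    rw [← hcomb]
    field_simp
    ring
  · intro t ht
    simp [(s.bc_u t ht).1, (s.bc_θ t ht).1]
  · intro t ht
    simp [(s.bc_u t ht).2, (s.bc_θ t ht).2]

theorem continuousOn_energy :
    ContinuousOn (Function.uncurry fun t r => s.ρ t r * ((s.u t r) ^ 2 / 2 + s.θ t r) * r)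
      (Icc 0 T ×ˢ Icc ε R) := by
  have cρ : ContinuousOn (fun p : ℝ × ℝ => s.ρ p.1 p.2) (Icc 0 T ×ˢ Icc ε R) :=
    s.smooth_ρ.continuousOn
  have cu : ContinuousOn (fun p : ℝ × ℝ => s.u p.1 p.2) (Icc 0 T ×ˢ Icc ε R) :=
    s.smooth_u.continuousOn
  have cθ : ContinuousOn (fun p : ℝ × ℝ => s.θ p.1 p.2) (Icc 0 T ×ˢ Icc ε R) :=
    s.smooth_θ.continuousOn
  unfold Function.uncurry
  fun_prop

theorem continuousOn_mass :
    ContinuousOn (Function.uncurry fun t r => s.ρ t r * r) (Icc 0 T ×ˢ Icc ε R) := by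
  have cρ : ContinuousOn (fun p : ℝ × ℝ => s.ρ p.1 p.2) (Icc 0 T ×ˢ Icc ε R) :=
    s.smooth_ρ.continuousOn
  unfold Function.uncurry
  fun_prop

theorem continuousOn_entropy :
    ContinuousOn (Function.uncurry fun t r =>
      s.ρ t r * (Real.log (s.θ t r) - K * Real.log (s.ρ t r)) * r) (Icc 0 T ×ˢ Icc ε R) := by
  have cρ : ContinuousOn (fun p : ℝ × ℝ => s.ρ p.1 p.2) (Icc 0 T ×ˢ Icc ε R) :=
    s.smooth_ρ.continuousOn
  have cθ : ContinuousOn (fun p : ℝ × ℝ => s.θ p.1 p.2) (Icc 0 T ×ˢ Icc ε R) :=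
    s.smooth_θ.continuousOn
  have clρ := cρ.log fun p hp => (s.ρ_pos p.1 hp.1 p.2 hp.2).ne'
  have clθ := cθ.log fun p hp => (s.θ_pos p.1 hp.1 p.2 hp.2).ne'
  unfold Function.uncurry
  fun_prop

theorem relative_entropy_eq {t r : ℝ} (ht : t ∈ Icc 0 T) (hr : r ∈ Icc ε R) :
    s.ρ t r * (K * Psi (1 / s.ρ t r) + Psi (s.θ t r) + (s.u t r) ^ 2 / 2) * r
      = s.ρ t r * ((s.u t r) ^ 2 / 2 + s.θ t r) * r
        - s.ρ t r * (Real.log (s.θ t r) - K * Real.log (s.ρ t r)) * r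
        - (K + 1) * (s.ρ t r * r) + K * r := by
  have hρ := (s.ρ_pos t ht r hr).ne'
  unfold Psi
  rw [one_div, Real.log_inv]
  field_simp
  ring

theorem intervalIntegrable_relative_entropy (hεR : ε < R) {t : ℝ} (ht : t ∈ Icc 0 T) :
    IntervalIntegrable
      (fun r => s.ρ t r * (K * Psi (1 / s.ρ t r) + Psi (s.θ t r) + (s.u t r) ^ 2 / 2) * r)
      volume ε R := by
  have hE := intervalIntegrable_slice hεR.le s.continuousOn_energy ht
  have hN := intervalIntegrable_slice hεR.le s.continuousOn_entropy ht
  have hM := intervalIntegrable_slice hεR.le s.continuousOn_mass ht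
  have hr : IntervalIntegrable (fun r : ℝ => K * r) volume ε R :=
    (by fun_prop : Continuous fun r : ℝ => K * r).intervalIntegrable _ _
  refine (((hE.sub hN).sub (hM.const_mul (K + 1))).add hr).congr ?_
  intro r hr
  rw [uIoc_of_le hεR.le] at hr
  exact (s.relative_entropy_eq ht (Ioc_subset_Icc_self hr)).symm

theorem integral_relative_entropy_eq (hεR : ε < R) {t : ℝ} (ht : t ∈ Icc 0 T) :
    (∫ r in ε..R, s.ρ t r * (K * Psi (1 / s.ρ t r) + Psi (s.θ t r) + (s.u t r) ^ 2 / 2) * r)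
      = (∫ r in ε..R, s.ρ t r * ((s.u t r) ^ 2 / 2 + s.θ t r) * r)
        - (∫ r in ε..R, s.ρ t r * (Real.log (s.θ t r) - K * Real.log (s.ρ t r)) * r)
        - (K + 1) * (∫ r in ε..R, s.ρ t r * r) + ∫ r in ε..R, K * r := by
  have hE := intervalIntegrable_slice hεR.le s.continuousOn_energy ht
  have hN := intervalIntegrable_slice hεR.le s.continuousOn_entropy ht
  have hM := intervalIntegrable_slice hεR.le s.continuousOn_mass ht
  have hr : IntervalIntegrable (fun r : ℝ => K * r) volume ε R :=
    (by fun_prop : Continuous fun r : ℝ => K * r).intervalIntegrable _ _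
  rw [← intervalIntegral.integral_const_mul, ← intervalIntegral.integral_sub hE hN,
    ← intervalIntegral.integral_sub (hE.sub hN) (hM.const_mul (K + 1)),
    ← intervalIntegral.integral_add ((hE.sub hN).sub (hM.const_mul (K + 1))) hr]
  refine intervalIntegral.integral_congr fun r hr => ?_
  rw [uIcc_of_le hεR.le] at hr
  exact s.relative_entropy_eq ht hr

/-- The initial energy is controlled by the initial relative entropy and the mass. -/
theorem initial_energy_le (hK : 0 < K) (hT : 0 < T) (hε : 0 < ε) (hεR : ε < R) :
    (∫ r in ε..R, s.ρ 0 r * ((s.u 0 r) ^ 2 / 2 + s.θ 0 r) * r) ≤ 2 * C₀ + 2 * M₀ := by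
  have h0 : (0 : ℝ) ∈ Icc 0 T := ⟨le_rfl, hT.le⟩
  have hE := intervalIntegrable_slice hεR.le s.continuousOn_energy h0
  have hM := intervalIntegrable_slice hεR.le s.continuousOn_mass h0
  have hS := s.intervalIntegrable_relative_entropy hεR h0
  calc (∫ r in ε..R, s.ρ 0 r * ((s.u 0 r) ^ 2 / 2 + s.θ 0 r) * r)
      ≤ ∫ r in ε..R, (2 * (s.ρ 0 r *
            (K * Psi (1 / s.ρ 0 r) + Psi (s.θ 0 r) + (s.u 0 r) ^ 2 / 2) * r)
          + 2 * (s.ρ 0 r * r)) := by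
        refine intervalIntegral.integral_mono_on hεR.le hE
          ((hS.const_mul 2).add (hM.const_mul 2)) fun r hr => ?_
        have hρ := s.ρ_pos 0 h0 r hr
        have hr0 : 0 < r := hε.trans_le hr.1
        have hθ := le_two_mul_Psi_add_two (s.θ_pos 0 h0 r hr)
        have hΨ := mul_nonneg hK.le (Psi_nonneg (one_div_pos.2 hρ))
        have hle : (s.u 0 r) ^ 2 / 2 + s.θ 0 r
            ≤ 2 * (K * Psi (1 / s.ρ 0 r) + Psi (s.θ 0 r) + (s.u 0 r) ^ 2 / 2) + 2 := by
          linarith [sq_nonneg (s.u 0 r)]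
        have := mul_le_mul_of_nonneg_left hle (mul_pos hρ hr0).le
        linarith
    _ ≤ 2 * C₀ + 2 * M₀ := by
        rw [intervalIntegral.integral_add (hS.const_mul 2) (hM.const_mul 2),
          intervalIntegral.integral_const_mul, intervalIntegral.integral_const_mul, s.init_mass]
        linarith [s.init_entropy]

theorem integral_energy_nonneg (hε : 0 < ε) (hεR : ε < R) {t : ℝ} (ht : t ∈ Icc 0 T) :
    0 ≤ ∫ r in ε..R, s.ρ t r * ((s.u t r) ^ 2 / 2 + s.θ t r) * r := by
  refine intervalIntegral.integral_nonneg hεR.le fun r hr => ?_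
  have hρ := s.ρ_pos t ht r hr
  have hθ := s.θ_pos t ht r hr
  have hr0 : 0 < r := hε.trans_le hr.1
  positivity

/-- Grönwall bound for the total energy. -/
theorem integral_energy_le (hT : 0 < T) (hM₀ : 0 < M₀) (hε : 0 < ε) (hεR : ε < R) {t : ℝ}
    (ht : t ∈ Icc 0 T) :
    (∫ r in ε..R, s.ρ t r * ((s.u t r) ^ 2 / 2 + s.θ t r) * r)
      ≤ ((∫ r in ε..R, s.ρ 0 r * ((s.u 0 r) ^ 2 / 2 + s.θ 0 r) * r) + M₀ / 2)
        * Real.exp Cf := by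
  obtain ⟨F, hFc, hFeq, hFle⟩ := exists_continuous_iSup_abs hT.le hεR.le s.smooth_f.continuousOn
  have hpowerc : ContinuousOn (Function.uncurry fun t r => s.ρ t r * s.f t r * s.u t r * r)
      (Icc 0 T ×ˢ Icc ε R) := by
    have cρ : ContinuousOn (fun p : ℝ × ℝ => s.ρ p.1 p.2) (Icc 0 T ×ˢ Icc ε R) :=
      s.smooth_ρ.continuousOn
    have cu : ContinuousOn (fun p : ℝ × ℝ => s.u p.1 p.2) (Icc 0 T ×ˢ Icc ε R) :=
      s.smooth_u.continuousOn
    have cf : ContinuousOn (fun p : ℝ × ℝ => s.f p.1 p.2) (Icc 0 T ×ˢ Icc ε R) :=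
      s.smooth_f.continuousOn
    unfold Function.uncurry
    fun_prop
  obtain ⟨p, hpc, hpeq⟩ := exists_continuous_eq_on_rectangle hT.le hεR.le hpowerc
  have hgc : Continuous fun τ => ∫ r in ε..R, p τ r :=
    intervalIntegral.continuous_parametric_intervalIntegral_of_continuous' hpc ε R
  have hpint : ∀ τ ∈ Icc 0 T,
      (∫ r in ε..R, p τ r) = ∫ r in ε..R, s.ρ τ r * s.f τ r * s.u τ r * r := by
    intro τ hτ
    refine intervalIntegral.integral_congr fun r hr => ?_
    rw [uIcc_of_le hεR.le] at hr
    exact hpeq τ hτ r hr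
  set E : ℝ → ℝ := fun t => ∫ r in ε..R, s.ρ t r * ((s.u t r) ^ 2 / 2 + s.θ t r) * r with hE
  have hbal : ∀ t ∈ Icc 0 T,
      E 0 + M₀ / 2 + (∫ τ in (0 : ℝ)..t, ∫ r in ε..R, p τ r) = E t + M₀ / 2 := by
    intro t ht
    have hcongr : (∫ τ in (0 : ℝ)..t, ∫ r in ε..R, p τ r)
        = ∫ τ in (0 : ℝ)..t, ∫ r in ε..R, s.ρ τ r * s.f τ r * s.u τ r * r := by
      refine intervalIntegral.integral_congr fun τ hτ => ?_
      rw [uIcc_of_le ht.1] at hτ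
      exact hpint τ (Icc_subset_Icc_right ht.2 hτ)
    rw [hcongr, ← s.integral_energy_sub hT hε hεR ht]
    simp only [hE]
    ring
  have hEnonneg : ∀ t ∈ Icc 0 T, 0 ≤ E t := fun t ht => s.integral_energy_nonneg hε hεR ht
  have hpower : ∀ t ∈ Icc 0 T, (∫ r in ε..R, p t r) ≤ F t * (E t + M₀ / 2) := by
    intro t ht
    have hEI := intervalIntegrable_slice hεR.le s.continuousOn_energy ht
    have hMI := intervalIntegrable_slice hεR.le s.continuousOn_mass ht
    have hPI := intervalIntegrable_slice hεR.le hpowerc ht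
    calc (∫ r in ε..R, p t r) = ∫ r in ε..R, s.ρ t r * s.f t r * s.u t r * r := hpint t ht
      _ ≤ ∫ r in ε..R, F t * (s.ρ t r * ((s.u t r) ^ 2 / 2 + s.θ t r) * r
            + 1 / 2 * (s.ρ t r * r)) := by
          refine intervalIntegral.integral_mono_on hεR.le hPI
            ((hEI.add (hMI.const_mul (1 / 2))).const_mul (F t)) fun r hr => ?_
          have hρ := s.ρ_pos t ht r hr
          have hθ := s.θ_pos t ht r hr
          have hr0 : 0 < r := hε.trans_le hr.1
          have hfu : s.f t r * s.u t r ≤ F t * ((s.u t r) ^ 2 / 2 + s.θ t r + 1 / 2) := by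
            have hF := hFle t ht r hr
            have hu : |s.u t r| ≤ (s.u t r) ^ 2 / 2 + s.θ t r + 1 / 2 := by
              nlinarith [sq_nonneg (|s.u t r| - 1), sq_abs (s.u t r)]
            calc s.f t r * s.u t r ≤ |s.f t r * s.u t r| := le_abs_self _
              _ = |s.f t r| * |s.u t r| := abs_mul _ _
              _ ≤ _ := mul_le_mul hF hu (abs_nonneg _) ((abs_nonneg _).trans hF)
          have := mul_le_mul_of_nonneg_left hfu (mul_pos hρ hr0).le
          linarith
      _ = F t * (E t + M₀ / 2) := by
          rw [intervalIntegral.integral_const_mul,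
            intervalIntegral.integral_add hEI (hMI.const_mul (1 / 2)),
            intervalIntegral.integral_const_mul, s.integral_mass hT hε hεR ht]
          ring
  have hgron := gronwall_of_pos hgc hFc
    (fun t ht => by rw [hbal t ht]; linarith [hEnonneg t ht])
    (fun t ht => by rw [hbal t ht]; exact hpower t ht) ht
  rw [hbal t ht] at hgron
  have hFnonneg : ∀ τ ∈ Icc 0 T, 0 ≤ F τ := fun τ hτ =>
    (abs_nonneg _).trans (hFle τ hτ ε ⟨le_rfl, hεR.le⟩)
  have hFint : (∫ τ in (0 : ℝ)..t, F τ) ≤ Cf := by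
    have hFT : (∫ τ in (0 : ℝ)..T, F τ) ≤ Cf := by
      refine le_of_eq_of_le ?_ s.force_int
      refine intervalIntegral.integral_congr fun τ hτ => ?_
      rw [uIcc_of_le hT.le] at hτ
      exact hFeq τ hτ
    have hsplit := intervalIntegral.integral_add_adjacent_intervals
      (hFc.intervalIntegrable (μ := volume) 0 t) (hFc.intervalIntegrable t T)
    have hrest : 0 ≤ ∫ τ in t..T, F τ :=
      intervalIntegral.integral_nonneg ht.2 fun τ hτ => hFnonneg τ ⟨ht.1.trans hτ.1, hτ.2⟩
    linarith
  have hy₀ : 0 ≤ E 0 + M₀ / 2 := by linarith [hEnonneg 0 ⟨le_rfl, hT.le⟩]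
  have hexp := mul_le_mul_of_nonneg_left (Real.exp_le_exp.2 hFint) hy₀
  change E t ≤ (E 0 + M₀ / 2) * Real.exp Cf
  linarith

end

end ApproxSol

/-- (Lemma 2.1: energy and entropy estimates) There is a constant `C > 0`, independent of `ε`,
such that every smooth approximate solution satisfies the mass identity, the energy bound and
the entropy estimate for all `t ∈ [0,T]`. -/
theorem energy_entropy_estimates
    (μ lam κ K R T C₀ M₀ Cf : ℝ)
    (hμ : 0 < μ) (hlam : 0 ≤ μ + lam) (hκ : 0 < κ) (hK : 0 < K)
    (hR : 0 < R) (hT : 0 < T) (hC₀ : 1 ≤ C₀) (hM₀ : 0 < M₀) (hCf : 0 < Cf) :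
    ∃ C : ℝ, 0 < C ∧ ∀ ε : ℝ, 0 < ε → ε < R →
      ∀ s : ApproxSol μ lam κ K ε R T C₀ M₀ Cf, ∀ t ∈ Icc (0:ℝ) T,
        ((∫ r in ε..R, s.ρ t r * r) = M₀) ∧
        ((∫ r in ε..R, s.ρ t r * ((s.u t r) ^ 2 / 2 + s.θ t r) * r) ≤ C) ∧
        ((∫ r in ε..R,
            s.ρ t r * (K * Psi (1 / s.ρ t r) + Psi (s.θ t r) + (s.u t r) ^ 2 / 2) * r)
          + (∫ τ in (0:ℝ)..t, ∫ r in ε..R,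
              (κ * (s.θr τ r / s.θ τ r) ^ 2
                + Qvisc μ lam (s.u τ r) (s.ur τ r) r / s.θ τ r) * r)
          ≤ C) := by
  have hE₁ : 0 < (2 * C₀ + 2 * M₀ + M₀ / 2) * Real.exp Cf := by positivity
  refine ⟨C₀ + (2 * C₀ + 2 * M₀ + M₀ / 2) * Real.exp Cf, by linarith, ?_⟩
  intro ε hε hεR s t ht
  have h0 : (0 : ℝ) ∈ Icc 0 T := ⟨le_rfl, hT.le⟩
  have hE : (∫ r in ε..R, s.ρ t r * ((s.u t r) ^ 2 / 2 + s.θ t r) * r)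
      ≤ (2 * C₀ + 2 * M₀ + M₀ / 2) * Real.exp Cf :=
    (s.integral_energy_le hT hM₀ hε hεR ht).trans <|
      mul_le_mul_of_nonneg_right (by linarith [s.initial_energy_le hK hT hε hεR])
        (Real.exp_pos _).le
  refine ⟨s.integral_mass hT hε hεR ht, by linarith, ?_⟩
  have hSt := s.integral_relative_entropy_eq hεR ht
  have hS0 := s.integral_relative_entropy_eq hεR h0
  rw [s.integral_mass hT hε hεR ht] at hSt
  rw [s.init_mass] at hS0
  have hN := s.integral_entropy_sub hT hε hεR ht
  have hE0 := s.integral_energy_nonneg hε hεR h0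
  linarith [s.init_entropy]
end
end

section
/- (Uniform lower bound on particle positions, estimate (3.3)) For every C > 0, h > 0 and R > 0 there exists δ > 0 such that: for every ε ∈ (0,R), every measurable function ρ : (ε,R) → (0,∞) satisfying the entropy-type bound ∫_ε^R (1 + ρ(r)·log ρ(r) − ρ(r)) r dr ≤ C, and every a ∈ (ε,R] with ∫_ε^a ρ(r) r dr ≥ h, one has a ≥ δ. -/
noncomputable section
open MeasureTheory Set

/-- The Young inequality for the conjugate pair `x log x - x` and `exp`. -/
theorem mul_le_mul_log_sub_self_add_exp {x : ℝ} (hx : 0 < x) (M : ℝ) :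
    M * x ≤ x * Real.log x - x + Real.exp M := by
  have h := mul_le_mul_of_nonneg_left (Real.add_one_le_exp (M - Real.log x)) hx.le
  rw [Real.exp_sub, Real.exp_log hx, mul_div_cancel₀ _ hx.ne'] at h
  linarith

/-- The mass on `(ε, a)` is controlled by the entropy on `(ε, R)` and by `a ^ 2`. -/
theorem mul_lintegral_mass_le {ε a R M : ℝ} {ρ : ℝ → ℝ} (hε : 0 < ε) (ha : ε < a) (haR : a ≤ R)
    (hM : 0 ≤ M) (hpos : ∀ r ∈ Ioo ε R, 0 < ρ r) :
    ENNReal.ofReal M * ∫⁻ r in Ioo ε a, ENNReal.ofReal (ρ r * r) ≤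
      (∫⁻ r in Ioo ε R, ENNReal.ofReal ((1 + ρ r * Real.log (ρ r) - ρ r) * r)) +
        ENNReal.ofReal (Real.exp M * a ^ 2) := by
  have ha0 : 0 < a := hε.trans ha
  have hpt : ∀ r ∈ Ioo ε a, ENNReal.ofReal M * ENNReal.ofReal (ρ r * r) ≤
      ENNReal.ofReal ((1 + ρ r * Real.log (ρ r) - ρ r) * r) +
        ENNReal.ofReal (Real.exp M * a) := by
    intro r hr
    have hr0 : 0 < r := hε.trans hr.1
    have hy := mul_le_mul_of_nonneg_right
      (mul_le_mul_log_sub_self_add_exp (hpos r ⟨hr.1, hr.2.trans_le haR⟩) M) hr0.le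
    have he := mul_le_mul_of_nonneg_left hr.2.le (Real.exp_pos M).le
    rw [← ENNReal.ofReal_mul hM]
    refine (ENNReal.ofReal_le_ofReal ?_).trans ENNReal.ofReal_add_le
    linarith
  calc ENNReal.ofReal M * ∫⁻ r in Ioo ε a, ENNReal.ofReal (ρ r * r)
      = ∫⁻ r in Ioo ε a, ENNReal.ofReal M * ENNReal.ofReal (ρ r * r) :=
        (lintegral_const_mul' _ _ ENNReal.ofReal_ne_top).symm
    _ ≤ ∫⁻ r in Ioo ε a, (ENNReal.ofReal ((1 + ρ r * Real.log (ρ r) - ρ r) * r) +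
          ENNReal.ofReal (Real.exp M * a)) := setLIntegral_mono' measurableSet_Ioo hpt
    _ = (∫⁻ r in Ioo ε a, ENNReal.ofReal ((1 + ρ r * Real.log (ρ r) - ρ r) * r)) +
          ENNReal.ofReal (Real.exp M * a * (a - ε)) := by
        rw [lintegral_add_right _ measurable_const, setLIntegral_const, Real.volume_Ioo,
          ← ENNReal.ofReal_mul (by positivity)]
    _ ≤ _ := by
        refine add_le_add (lintegral_mono_set (Ioo_subset_Ioo_right haR))
          (ENNReal.ofReal_le_ofReal ?_)
        have := mul_pos (mul_pos (Real.exp_pos M) ha0) hε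
        linarith

/-- (Uniform lower bound on particle positions, estimate (3.3)) Given `C, h, R > 0`, there is
`δ > 0` such that for every `ε ∈ (0,R)` and every strictly positive measurable `ρ` on `(ε,R)`
with `∫_ε^R (1 + ρ log ρ − ρ) r dr ≤ C`, any `a ∈ (ε,R]` with `∫_ε^a ρ r dr ≥ h`
satisfies `a ≥ δ`. -/
theorem particle_position_lower_bound (C h R : ℝ) (hC : 0 < C) (hh : 0 < h) (hR : 0 < R) :
    ∃ δ > 0, ∀ ε : ℝ, 0 < ε → ε < R → ∀ ρ : ℝ → ℝ, Measurable ρ →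
      (∀ r ∈ Ioo ε R, 0 < ρ r) →
      (∫⁻ r in Ioo ε R, ENNReal.ofReal ((1 + ρ r * Real.log (ρ r) - ρ r) * r))
        ≤ ENNReal.ofReal C →
      ∀ a : ℝ, ε < a → a ≤ R →
        ENNReal.ofReal h ≤ (∫⁻ r in Ioo ε a, ENNReal.ofReal (ρ r * r)) →
        δ ≤ a := by
  refine ⟨√(C * Real.exp (-(2 * C / h))), Real.sqrt_pos.2 (by positivity), ?_⟩
  intro ε hε _ ρ _ hpos hent a ha haR hmass
  have hM : 0 ≤ 2 * C / h := by positivity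
  have key := (mul_le_mul_right hmass (ENNReal.ofReal (2 * C / h))).trans
    ((mul_lintegral_mass_le hε ha haR hM hpos).trans (add_le_add_left hent _))
  rw [← ENNReal.ofReal_mul hM, ← ENNReal.ofReal_add hC.le (by positivity),
    ENNReal.ofReal_le_ofReal_iff (by positivity), div_mul_cancel₀ _ hh.ne'] at key
  refine Real.sqrt_le_iff.2 ⟨(hε.trans ha).le, ?_⟩
  rw [Real.exp_neg, ← div_eq_mul_inv, div_le_iff₀ (Real.exp_pos _)]
  linarith
end
end
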